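/- Let 0 < R₁, R₂ ≤ 1, α ∈ Dom_{R₁}, β ∈ Dom_{R₂}, and let H_α(N), H_β(N) be the Taylor coefficients at 0 of Li_α(z)/(1−z) and Li_β(z)/(1−z). Then α ⧛ β ∈ Dom_{R₁R₂}, i.e. Σ_{n≥0} sup_{|z|≤r} |Li_{(α⧛β)_n}(z)| < ∞ for every r ∈ (0, R₁R₂); and for every z ∈ ℂ with |z| < R₁R₂: Σ_{N≥0} H_α(N)·H_β(N)·z^N = Li_{α⧛β}(z)/(1−z), where Li_{α⧛β}(z) := Σ_{n≥0} Li_{(α⧛β)_n}(z). (This is the Hadamard-product identity (Li_α(z)/(1−z)) ⊙ (Li_β(z)/(1−z)) = Li_{α⧛β}(z)/(1−z).) -/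

import Mathlib

open scoped NNReal ENNReal

/-- A composition: a finite list of positive integers. -/
abbrev Comp := List ℕ+

/-- Harmonic sum `H_s(N) = Σ_{N ≥ n₁ > … > n_r > 0} 1/(n₁^{s₁} ⋯ n_r^{s_r})`,
with `H_ε(N) = 1`. -/
noncomputable def Hc : Comp → ℕ → ℂ
  | [], _ => 1
  | s :: u, N => ∑ n ∈ Finset.Icc 1 N, ((n : ℂ) ^ (s : ℕ))⁻¹ * Hc u (n - 1)

/-- Polylogarithm `Li_s(z) = Σ_{n₁ > … > n_r > 0} z^{n₁}/(n₁^{s₁} ⋯ n_r^{s_r})`,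
with `Li_ε = 1` (the `n = 0` term of the `tsum` vanishes since `s ≥ 1`). -/
noncomputable def LiC : Comp → ℂ → ℂ
  | [], _ => 1
  | s :: u, z => ∑' n : ℕ, z ^ n * ((n : ℂ) ^ (s : ℕ))⁻¹ * Hc u (n - 1)

/-- Weight of a composition. -/
def wt (s : Comp) : ℕ := (s.map fun p => (p : ℕ)).sum

/-- `Li_P(z) = Σ_s P(s)·Li_s(z)` for a (finitely supported) function `P` on
compositions. -/
noncomputable def LiP (P : Comp → ℂ) (z : ℂ) : ℂ := ∑' s : Comp, P s * LiC s z

/-- `H_P(N) = Σ_s P(s)·H_s(N)` for a (finitely supported) function `P` on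
compositions. -/
noncomputable def HP (P : Comp → ℂ) (N : ℕ) : ℂ := ∑' s : Comp, P s * Hc s N

/-- Weight-`n` homogeneous component of a function on compositions. -/
def homog (α : Comp → ℂ) (n : ℕ) : Comp → ℂ := fun s => if wt s = n then α s else 0

/-- `Dom_R`: the set of `α` with `Σ_n sup_{|z|≤r} |Li_{α,n}(z)| < ∞` for every
`r ∈ (0,R)`. -/
noncomputable def DomR (R : ℝ) : Set (Comp → ℂ) :=
  {α | ∀ r : ℝ, 0 < r → r < R →
    (∑' n : ℕ, ⨆ z ∈ Metric.closedBall (0 : ℂ) r, (‖LiP (homog α n) z‖₊ : ℝ≥0∞)) < ⊤}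

/-- Stuffle coefficient on compositions: `⟨u ⧛ v, w⟩`, defined by
`u ⧛ ε = ε ⧛ u = u` and
`(s::u) ⧛ (t::v) = s::(u ⧛ (t::v)) + t::((s::u) ⧛ v) + (s+t)::(u ⧛ v)`. -/
def stuf : Comp → Comp → Comp → ℤ
  | [], v, w => if w = v then 1 else 0
  | u, [], w => if w = u then 1 else 0
  | _ :: _, _ :: _, [] => 0
  | s :: u, t :: v, c :: w =>
      (if c = s then stuf u (t :: v) w else 0) +
      (if c = t then stuf (s :: u) v w else 0) +
      (if c = s + t then stuf u v w else 0)
termination_by u v _ => u.length + v.length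

/-- Bilinear extension of the stuffle to `ℂ`-valued functions on compositions
(a finite sum for each `w`, realized as a `tsum`). -/
noncomputable def stufA (α β : Comp → ℂ) : Comp → ℂ :=
  fun w => ∑' p : Comp × Comp, α p.1 * β p.2 * (stuf p.1 p.2 w : ℂ)


lemma Hc_norm_le (s : Comp) : ∀ N : ℕ, ‖Hc s N‖ ≤ (N : ℝ) ^ s.length := by
  induction s with
  | nil => intro N; simp [Hc]
  | cons s u ih =>
    intro N
    rw [Hc]
    refine (norm_sum_le _ _).trans ?_
    have : ∀ n ∈ Finset.Icc 1 N, ‖((n : ℂ) ^ (s : ℕ))⁻¹ * Hc u (n - 1)‖ ≤ (N : ℝ) ^ u.length := by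
      intro n hn
      rw [Finset.mem_Icc] at hn
      rw [norm_mul, norm_inv, norm_pow, Complex.norm_natCast]
      have h1 : (1 : ℝ) ≤ (n : ℝ) ^ (s : ℕ) := one_le_pow₀ (by exact_mod_cast hn.1)
      have h2 : ‖Hc u (n - 1)‖ ≤ (N : ℝ) ^ u.length := by
        refine (ih _).trans ?_
        gcongr
        omega
      calc _ ≤ 1 * (N : ℝ) ^ u.length := by
            gcongr
            exact inv_le_one_of_one_le₀ h1
        _ = _ := one_mul _
    refine (Finset.sum_le_card_nsmul _ _ _ this).trans ?_
    simp [pow_succ, mul_comm]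

lemma Hc_succ (s : ℕ+) (u : Comp) (N : ℕ) :
    Hc (s :: u) (N + 1) = Hc (s :: u) N + (((N + 1 : ℕ) : ℂ) ^ (s : ℕ))⁻¹ * Hc u N := by
  rw [Hc, Hc, Finset.sum_Icc_succ_top (by omega)]
  simp

lemma Hc_zero (s : ℕ+) (u : Comp) : Hc (s :: u) 0 = 0 := by
  rw [Hc]; simp

lemma Hc_summable (s : Comp) (z : ℂ) (hz : ‖z‖ < 1) : Summable fun N : ℕ => Hc s N * z ^ N := by
  have h := summable_pow_mul_geometric_of_norm_lt_one (R := ℝ) s.length (r := ‖z‖) (by simpa using hz)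
  refine Summable.of_norm_bounded h fun N => ?_
  rw [norm_mul, norm_pow]
  gcongr
  exact Hc_norm_le s N

lemma Hc_hasSum (s : Comp) (z : ℂ) (hz : ‖z‖ < 1) :
    HasSum (fun N : ℕ => Hc s N * z ^ N) (LiC s z / (1 - z)) := by
  have hz1 : (1 - z) ≠ 0 := by
    intro h
    rw [sub_eq_zero] at h
    rw [← h] at hz
    simp at hz
  cases s with
  | nil => simpa [Hc, LiC] using hasSum_geometric_of_norm_lt_one hz
  | cons s u =>
    have hS := Hc_summable (s :: u) z hz
    have h1 := hS.hasSum
    convert h1 using 1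
    rw [div_eq_iff hz1]
    set S := ∑' N, Hc (s :: u) N * z ^ N with hSd
    have h2 := (hasSum_nat_add_iff' 1).2 h1
    have h3 := h2.sub (h1.mul_left z)
    have h4 : HasSum (fun n : ℕ => z ^ n * ((n : ℂ) ^ (s : ℕ))⁻¹ * Hc u (n - 1)) (S - z * S) := by
      rw [← hasSum_nat_add_iff' 1]
      convert h3 using 1
      · funext n
        rw [Hc_succ]
        simp only [Nat.add_sub_cancel]
        ring
      · simp [Hc_zero]
    rw [LiC, h4.tsum_eq]; ring

lemma wt_le_finite (n : ℕ) : {s : Comp | wt s ≤ n}.Finite := by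
  induction n with
  | zero =>
    refine (Set.finite_singleton ([] : Comp)).subset ?_
    intro s hs
    cases s with
    | nil => simp
    | cons a u =>
      have := a.pos
      simp [wt] at hs
  | succ n ih =>
    refine ((Set.finite_singleton ([] : Comp)).union
      (Set.Finite.image2 List.cons (Set.finite_Iic (n.succPNat)) ih)).subset ?_
    intro s hs
    cases s with
    | nil => simp
    | cons a u =>
      right
      have := a.pos
      simp [wt] at hs
      refine ⟨a, ?_, u, ?_, rfl⟩
      · rw [Set.mem_Iic, ← PNat.coe_le_coe]
        simp
        omega
      · simp [wt]
        omega

noncomputable def wF (n : ℕ) : Finset Comp := (wt_le_finite n).toFinset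

lemma mem_wF {n : ℕ} {s : Comp} : s ∈ wF n ↔ wt s ≤ n := by simp [wF]

lemma LiP_homog (α : Comp → ℂ) {p n : ℕ} (h : p ≤ n) (z : ℂ) :
    LiP (homog α p) z = ∑ s ∈ wF n, homog α p s * LiC s z := by
  refine tsum_eq_sum fun s hs => ?_
  rw [mem_wF] at hs
  have : wt s ≠ p := by omega
  simp [homog, this]

lemma HP_homog (α : Comp → ℂ) {p n : ℕ} (h : p ≤ n) (N : ℕ) :
    HP (homog α p) N = ∑ s ∈ wF n, homog α p s * Hc s N := by
  refine tsum_eq_sum fun s hs => ?_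
  rw [mem_wF] at hs
  have : wt s ≠ p := by omega
  simp [homog, this]

lemma HP_hasSum (α : Comp → ℂ) (n : ℕ) (z : ℂ) (hz : ‖z‖ < 1) :
    HasSum (fun N : ℕ => HP (homog α n) N * z ^ N) (LiP (homog α n) z / (1 - z)) := by
  rw [LiP_homog α le_rfl, Finset.sum_div]
  simp_rw [HP_homog α (le_refl n), Finset.sum_mul, mul_div_assoc, mul_assoc]
  exact hasSum_sum fun s _ => (Hc_hasSum s z hz).mul_left _

lemma stuf_nil_left (v w : Comp) : stuf [] v w = if w = v then 1 else 0 := by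
  rw [stuf]

lemma stuf_nil_right (u w : Comp) : stuf u [] w = if w = u then 1 else 0 := by
  cases u <;> rw [stuf]
  simp

lemma stuf_cons_nil (s t : ℕ+) (u v : Comp) : stuf (s :: u) (t :: v) [] = 0 := by
  rw [stuf]

lemma stuf_cons_cons (s t c : ℕ+) (u v w : Comp) : stuf (s :: u) (t :: v) (c :: w) =
      (if c = s then stuf u (t :: v) w else 0) +
      (if c = t then stuf (s :: u) v w else 0) +
      (if c = s + t then stuf u v w else 0) := by
  rw [stuf]

lemma wt_cons (s : ℕ+) (u : Comp) : wt (s :: u) = s + wt u := by simp [wt]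

lemma stuf_wt : ∀ (u v w : Comp), stuf u v w ≠ 0 → wt w = wt u + wt v
  | [], v, w => by
    rw [stuf_nil_left]; intro h
    have : w = v := by by_contra h'; simp [h'] at h
    simp [this, wt]
  | s :: u, [], w => by
    rw [stuf_nil_right]; intro h
    have : w = s :: u := by by_contra h'; simp [h'] at h
    simp [this, wt]
  | s :: u, t :: v, [] => by simp [stuf_cons_nil]
  | s :: u, t :: v, c :: w => by
    rw [stuf_cons_cons]
    intro h
    have h1 := stuf_wt u (t :: v) w
    have h2 := stuf_wt (s :: u) v w
    have h3 := stuf_wt u v w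
    simp only [wt_cons] at *
    by_cases a1 : c = s ∧ stuf u (t :: v) w ≠ 0
    · have := h1 a1.2; rw [a1.1]; omega
    by_cases a2 : c = t ∧ stuf (s :: u) v w ≠ 0
    · have := h2 a2.2; rw [a2.1]; omega
    by_cases a3 : c = s + t ∧ stuf u v w ≠ 0
    · have := h3 a3.2; rw [a3.1, PNat.add_coe]; omega
    exfalso
    apply h
    simp only [not_and, not_not] at a1 a2 a3
    have e1 : (if c = s then stuf u (t :: v) w else 0) = 0 := by
      split_ifs with h'
      · exact a1 h'
      · rfl
    have e2 : (if c = t then stuf (s :: u) v w else 0) = 0 := by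
      split_ifs with h'
      · exact a2 h'
      · rfl
    have e3 : (if c = s + t then stuf u v w else 0) = 0 := by
      split_ifs with h'
      · exact a3 h'
      · rfl
    rw [e1, e2, e3]; rfl
termination_by u v _ => u.length + v.length

def consF (s : ℕ+) (g : Comp → ℂ) : Comp → ℂ
  | [] => 0
  | c :: w => if c = s then g w else 0

lemma consF_hasSum (s : ℕ+) (g : Comp → ℂ) (a : ℂ) (h : HasSum g a) : HasSum (consF s g) a := by
  have hi : Function.Injective (fun w : Comp => s :: w) := List.cons_injective
  rw [← hi.hasSum_iff]
  · convert h using 1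
    funext w
    simp [consF]
  · intro x hx
    cases x with
    | nil => rfl
    | cons c w =>
      have : c ≠ s := by rintro rfl; exact hx ⟨w, rfl⟩
      simp [consF, this]

lemma Hc_cons_hasSum (s : ℕ+) (f : Comp → ℂ) (a : ℕ → ℂ)
    (h : ∀ N, HasSum (fun w => f w * Hc w N) (a N)) (N : ℕ) :
    HasSum (fun w => f w * Hc (s :: w) N)
      (∑ n ∈ Finset.Icc 1 N, ((n : ℂ) ^ (s : ℕ))⁻¹ * a (n - 1)) := by
  have := hasSum_sum (s := Finset.Icc 1 N) fun n _ =>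
    (h (n - 1)).mul_left (((n : ℂ) ^ (s : ℕ))⁻¹)
  have he : (fun w => f w * Hc (s :: w) N) = fun w => ∑ n ∈ Finset.Icc 1 N,
      ((n : ℂ) ^ (s : ℕ))⁻¹ * (f w * Hc w (n - 1)) := by
    funext w
    rw [Hc, Finset.mul_sum]
    refine Finset.sum_congr rfl fun n _ => ?_
    ring
  rw [he]
  exact this

lemma Hc_mul (s t : ℕ+) (u v : Comp) (N : ℕ) :
    Hc (s :: u) N * Hc (t :: v) N =
    (∑ n ∈ Finset.Icc 1 N, ((n : ℂ) ^ (s : ℕ))⁻¹ * (Hc u (n - 1) * Hc (t :: v) (n - 1))) +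
    (∑ n ∈ Finset.Icc 1 N, ((n : ℂ) ^ (t : ℕ))⁻¹ * (Hc (s :: u) (n - 1) * Hc v (n - 1))) +
    (∑ n ∈ Finset.Icc 1 N, ((n : ℂ) ^ ((s + t : ℕ+) : ℕ))⁻¹ * (Hc u (n - 1) * Hc v (n - 1))) := by
  induction N with
  | zero => simp [Hc_zero]
  | succ N ih =>
    simp only [Finset.sum_Icc_succ_top (show 1 ≤ N + 1 by omega), Nat.add_sub_cancel]
    rw [Hc_succ, Hc_succ]
    have e : (((N + 1 : ℕ) : ℂ) ^ ((s + t : ℕ+) : ℕ))⁻¹ =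
        (((N + 1 : ℕ) : ℂ) ^ (s : ℕ))⁻¹ * (((N + 1 : ℕ) : ℂ) ^ (t : ℕ))⁻¹ := by
      rw [PNat.add_coe, pow_add, mul_inv]
    rw [e]
    linear_combination ih

lemma stuf_hasSum : ∀ (u v : Comp) (N : ℕ),
    HasSum (fun w => (stuf u v w : ℂ) * Hc w N) (Hc u N * Hc v N)
  | [], v, N => by
    convert hasSum_single (f := fun w => (stuf [] v w : ℂ) * Hc w N) v ?_ using 1
    · simp [stuf_nil_left, Hc]
    · intro w hw; simp [stuf_nil_left, hw]
  | s :: u, [], N => by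
    convert hasSum_single (f := fun w => (stuf (s :: u) [] w : ℂ) * Hc w N) (s :: u) ?_ using 1
    · rw [stuf_nil_right, Hc]; simp [Hc]
    · intro w hw; simp [stuf_nil_right, hw]
  | s :: u, t :: v, N => by
    have h1 := consF_hasSum s _ _ (Hc_cons_hasSum s _ _ (fun N => stuf_hasSum u (t :: v) N) N)
    have h2 := consF_hasSum t _ _ (Hc_cons_hasSum t _ _ (fun N => stuf_hasSum (s :: u) v N) N)
    have h3 := consF_hasSum (s + t) _ _ (Hc_cons_hasSum (s + t) _ _ (fun N => stuf_hasSum u v N) N)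
    rw [Hc_mul]
    convert (h1.add h2).add h3 using 1
    funext w
    cases w with
    | nil => simp [consF, stuf_cons_nil]
    | cons c w =>
      simp only [consF, stuf_cons_cons]
      push_cast
      simp only [add_mul, ite_mul, zero_mul]
      congr 1
      · congr 1
        · split_ifs with h
          · rw [h]
          · rfl
        · split_ifs with h
          · rw [h]
          · rfl
      · split_ifs with h
        · rw [h]
        · rfl
termination_by u v _ => u.length + v.length

lemma homog_stufA (α β : Comp → ℂ) (n : ℕ) (w : Comp) :
    homog (stufA α β) n w = ∑ u ∈ wF n, ∑ v ∈ wF n,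
      if wt u + wt v = n then α u * β v * (stuf u v w : ℂ) else 0 := by
  by_cases hw : wt w = n
  · simp only [homog, hw, if_true, stufA]
    rw [← Finset.sum_product', tsum_eq_sum (s := wF n ×ˢ wF n)]
    · refine Finset.sum_congr rfl fun p _ => ?_
      split_ifs with h
      · rfl
      · have : stuf p.1 p.2 w = 0 := by
          by_contra h'
          exact h (by rw [← stuf_wt _ _ _ h', hw])
        simp [this]
    · intro p hp
      have : stuf p.1 p.2 w = 0 := by
        by_contra h'
        have := stuf_wt _ _ _ h'
        apply hp
        rw [Finset.mem_product, mem_wF, mem_wF]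
        omega
      simp [this]
  · simp only [homog, hw, if_false]
    symm
    refine Finset.sum_eq_zero fun u _ => Finset.sum_eq_zero fun v _ => ?_
    split_ifs with h
    · have : stuf u v w = 0 := by
        by_contra h'
        exact hw (by rw [stuf_wt _ _ _ h', h])
      simp [this]
    · rfl

lemma HP_stufA (α β : Comp → ℂ) (n N : ℕ) :
    HP (homog (stufA α β) n) N =
      ∑ pq ∈ Finset.HasAntidiagonal.antidiagonal n, HP (homog α pq.1) N * HP (homog β pq.2) N := by
  have hL : HasSum (fun w => homog (stufA α β) n w * Hc w N)
      (∑ u ∈ wF n, ∑ v ∈ wF n,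
        if wt u + wt v = n then α u * β v * (Hc u N * Hc v N) else 0) := by
    simp_rw [homog_stufA, Finset.sum_mul]
    refine hasSum_sum fun u _ => hasSum_sum fun v _ => ?_
    split_ifs
    · simp_rw [mul_assoc (α u * β v)]
      exact (stuf_hasSum u v N).mul_left _
    · simp
  rw [HP, hL.tsum_eq]
  have hR : ∀ pq ∈ Finset.HasAntidiagonal.antidiagonal n, HP (homog α pq.1) N * HP (homog β pq.2) N =
      ∑ u ∈ wF n, ∑ v ∈ wF n, if (wt u, wt v) = pq then α u * β v * (Hc u N * Hc v N) else 0 := by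
    rintro ⟨p, q⟩ h
    rw [Finset.HasAntidiagonal.mem_antidiagonal] at h
    simp only at h
    rw [HP_homog α (show p ≤ n by omega), HP_homog β (show q ≤ n by omega), Finset.sum_mul_sum]
    refine Finset.sum_congr rfl fun u _ => Finset.sum_congr rfl fun v _ => ?_
    simp only [homog, Prod.mk.injEq]
    by_cases h1 : wt u = p
    · by_cases h2 : wt v = q
      · simp only [h1, h2, and_self, if_true]
        ring
      · simp [h2]
    · simp [h1]
  symm
  rw [Finset.sum_congr rfl hR, Finset.sum_comm]
  refine Finset.sum_congr rfl fun u _ => ?_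
  rw [Finset.sum_comm]
  refine Finset.sum_congr rfl fun v _ => ?_
  rw [Finset.sum_ite_eq]
  simp only [Finset.HasAntidiagonal.mem_antidiagonal]

lemma hasFPS {c : ℕ → ℂ} {f : ℂ → ℂ} {R : ℝ≥0} (hR : 0 < R)
    (h : ∀ z : ℂ, ‖z‖ < R → HasSum (fun N : ℕ => c N * z ^ N) (f z)) :
    HasFPowerSeriesOnBall f (.ofScalars ℂ c) 0 R := by
  constructor
  · refine le_of_forall_lt_imp_le_of_dense fun r hr ↦ ?_
    lift r to NNReal using hr.ne_top
    apply FormalMultilinearSeries.le_radius_of_summable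
    simpa [FormalMultilinearSeries.ofScalars_norm] using
      (h (r : ℂ) (by simpa using hr)).summable.norm
  · simpa using hR
  · intro y hy
    rw [Metric.eball_coe, mem_ball_zero_iff] at hy
    simpa [mul_comm] using h y hy

lemma coeff_unique {c d : ℕ → ℂ} {f : ℂ → ℂ} {R : ℝ} (hR : 0 < R)
    (hc : ∀ z : ℂ, ‖z‖ < R → HasSum (fun N : ℕ => c N * z ^ N) (f z))
    (hd : ∀ z : ℂ, ‖z‖ < R → HasSum (fun N : ℕ => d N * z ^ N) (f z)) : c = d := by
  lift R to ℝ≥0 using hR.le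
  have hR' : 0 < R := by exact_mod_cast hR
  have h1 := (hasFPS hR' hc).hasFPowerSeriesAt
  have h2 := (hasFPS hR' hd).hasFPowerSeriesAt
  exact FormalMultilinearSeries.ofScalars_series_injective ℂ ℂ (h1.eq_formalMultilinearSeries h2)

lemma coeff_bound {c : ℕ → ℂ} {f : ℂ → ℂ} {r C : ℝ} (hr : 0 < r) (hr1 : r < 1)
    (hc : ∀ z : ℂ, ‖z‖ < 1 → HasSum (fun N : ℕ => c N * z ^ N) (f z))
    (hC : ∀ z : ℂ, ‖z‖ = r → ‖f z‖ ≤ C) (N : ℕ) : ‖c N‖ ≤ C / r ^ N := by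
  have h1 := hasFPS (R := 1) one_pos (by simpa using hc)
  have hd : DifferentiableOn ℂ f (Metric.ball 0 1) := by
    have := h1.differentiableOn
    rwa [Metric.eball_coe, NNReal.coe_one] at this
  have hcl : DiffContOnCl ℂ f (Metric.ball 0 r) := by
    apply DifferentiableOn.diffContOnCl
    rw [closure_ball _ hr.ne']
    exact hd.mono (Metric.closedBall_subset_ball hr1)
  have h2 := Complex.norm_iteratedDeriv_le_of_forall_mem_sphere_norm_le (C := C) N hr hcl
    (by intro z hz; exact hC z (by simpa using hz))
  have h3 := h1.factorial_smul 1 N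
  rw [← iteratedDeriv_eq_iteratedFDeriv] at h3
  rw [← h3] at h2
  simp only [FormalMultilinearSeries.ofScalars_apply_eq, one_pow, smul_eq_mul, mul_one,
    nsmul_eq_mul, norm_mul, Complex.norm_natCast] at h2
  rw [mul_div_assoc] at h2
  exact le_of_mul_le_mul_left h2 (by exact_mod_cast N.factorial_pos)

lemma dom_bound {α : Comp → ℂ} {R r : ℝ} (hR1 : R ≤ 1) (hα : α ∈ DomR R) (hr0 : 0 < r)
    (hr : r < R) : ∃ A : ℕ → ℝ, (∀ p, 0 ≤ A p) ∧ Summable A ∧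
      ∀ p N, ‖HP (homog α p) N‖ ≤ A p / r ^ N := by
  have h := hα r hr0 hr
  have hr1 : r < 1 := hr.trans_le hR1
  set M : ℕ → ℝ≥0∞ := fun n => ⨆ z ∈ Metric.closedBall (0 : ℂ) r, (‖LiP (homog α n) z‖₊ : ℝ≥0∞)
    with hM
  have hMt : ∀ n, M n ≠ ⊤ := fun n => ENNReal.ne_top_of_tsum_ne_top h.ne n
  refine ⟨fun p => (M p).toReal / (1 - r), fun p => ?_, ?_, fun p N => ?_⟩
  · have : 0 < 1 - r := by linarith
    positivity
  · exact (ENNReal.summable_toReal h.ne).div_const _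
  · refine coeff_bound hr0 hr1 (fun z hz => HP_hasSum α p z hz) (fun z hz => ?_) N
    rw [norm_div]
    have h1 : ‖LiP (homog α p) z‖ ≤ (M p).toReal := by
      have : (‖LiP (homog α p) z‖₊ : ℝ≥0∞) ≤ M p :=
        le_iSup₂ (f := fun z (_ : z ∈ Metric.closedBall (0 : ℂ) r) =>
          (‖LiP (homog α p) z‖₊ : ℝ≥0∞)) z (by simp [hz])
      have := ENNReal.toReal_mono (hMt p) this
      simpa using this
    have h2 : 1 - r ≤ ‖1 - z‖ := by
      have := norm_sub_norm_le (1 : ℂ) z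
      rw [hz] at this
      simpa using this
    have : 0 < 1 - r := by linarith
    exact div_le_div₀ ENNReal.toReal_nonneg h1 this h2

lemma summable_double {γ : Comp → ℂ} {ρ : ℝ} (hρ : 0 < ρ) {B : ℕ → ℝ}
    (hBs : Summable B) (hb : ∀ n N, ‖HP (homog γ n) N‖ ≤ B n / ρ ^ N)
    (z : ℂ) (hz : ‖z‖ < ρ) :
    Summable fun p : ℕ × ℕ => HP (homog γ p.1) p.2 * z ^ p.2 := by
  have hB0 : ∀ n, 0 ≤ B n := fun n => by
    have := (norm_nonneg _).trans (hb n 0)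
    simpa using this
  have hq : ‖z‖ / ρ < 1 := (div_lt_one hρ).2 hz
  have hg := summable_geometric_of_lt_one (by positivity) hq
  refine Summable.of_norm_bounded (hBs.mul_of_nonneg hg hB0 (fun _ => by positivity)) ?_
  rintro ⟨n, N⟩
  rw [norm_mul, norm_pow]
  simp only
  calc _ ≤ B n / ρ ^ N * ‖z‖ ^ N := by gcongr; exact hb n N
    _ = _ := by rw [div_pow]; ring

lemma hasSum_total {γ : Comp → ℂ} {ρ : ℝ} (hρ : 0 < ρ) (hρ1 : ρ ≤ 1) {B : ℕ → ℝ}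
    (hBs : Summable B) (hb : ∀ n N, ‖HP (homog γ n) N‖ ≤ B n / ρ ^ N)
    (z : ℂ) (hz : ‖z‖ < ρ) :
    HasSum (fun N : ℕ => (∑' n, HP (homog γ n) N) * z ^ N)
      ((∑' n : ℕ, LiP (homog γ n) z) / (1 - z)) := by
  have hS := summable_double hρ hBs hb z hz
  have h1 : HasSum (fun n => LiP (homog γ n) z / (1 - z)) (∑' p : ℕ × ℕ, HP (homog γ p.1) p.2 * z ^ p.2) :=
    hS.hasSum.prod_fiberwise fun n => HP_hasSum γ n z (hz.trans_le hρ1)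
  have hS' := hS.prod_symm
  have h2 := hS'.hasSum.prod_fiberwise fun N => (hS'.prod_factor N).hasSum
  have h3 : (∑' p : ℕ × ℕ, HP (homog γ p.swap.1) p.swap.2 * z ^ p.swap.2) =
      ∑' p : ℕ × ℕ, HP (homog γ p.1) p.2 * z ^ p.2 :=
    (Equiv.prodComm ℕ ℕ).tsum_eq (fun p : ℕ × ℕ => HP (homog γ p.1) p.2 * z ^ p.2)
  rw [h3, ← h1.tsum_eq, tsum_div_const] at h2
  simpa only [Prod.swap, tsum_mul_right] using h2

lemma mem_dom {γ : Comp → ℂ} {r ρ : ℝ} (hr : 0 < r) (hrρ : r < ρ) (hρ1 : ρ ≤ 1) {B : ℕ → ℝ}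
    (hBs : Summable B) (hb : ∀ n N, ‖HP (homog γ n) N‖ ≤ B n / ρ ^ N) :
    (∑' n : ℕ, ⨆ z ∈ Metric.closedBall (0 : ℂ) r, (‖LiP (homog γ n) z‖₊ : ℝ≥0∞)) < ⊤ := by
  have hρ : 0 < ρ := hr.trans hrρ
  have hB0 : ∀ n, 0 ≤ B n := fun n => by
    have := (norm_nonneg _).trans (hb n 0)
    simpa using this
  have hq : r / ρ < 1 := (div_lt_one hρ).2 hrρ
  have hg := hasSum_geometric_of_lt_one (by positivity) hq
  set K : ℝ := (1 - r / ρ)⁻¹ * 2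
  have hle : ∀ n, (⨆ z ∈ Metric.closedBall (0 : ℂ) r, (‖LiP (homog γ n) z‖₊ : ℝ≥0∞)) ≤
      ENNReal.ofReal (B n * K) := by
    intro n
    refine iSup₂_le fun z hz => ?_
    have hz' : ‖z‖ ≤ r := by simpa using hz
    have hz1 : ‖z‖ < 1 := by linarith
    have h1 := HP_hasSum γ n z hz1
    have h2 : ‖LiP (homog γ n) z / (1 - z)‖ ≤ B n * (1 - r / ρ)⁻¹ := by
      rw [← h1.tsum_eq]
      refine tsum_of_norm_bounded (hg.mul_left (B n)) fun N => ?_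
      rw [norm_mul, norm_pow]
      calc _ ≤ B n / ρ ^ N * r ^ N := by
            have := hB0 n
            gcongr
            exact hb n N
        _ = _ := by rw [div_pow]; ring
    have hne : (1 - z) ≠ 0 := by
      intro h
      rw [sub_eq_zero] at h
      rw [← h] at hz1
      simp at hz1
    have h3 : ‖1 - z‖ ≤ 2 := by
      have := norm_sub_le (1 : ℂ) z
      rw [norm_one] at this
      linarith
    have h4 : ‖LiP (homog γ n) z‖ ≤ B n * K := by
      have e : LiP (homog γ n) z = LiP (homog γ n) z / (1 - z) * (1 - z) := by field_simp
      rw [e, norm_mul]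
      calc _ ≤ B n * (1 - r / ρ)⁻¹ * 2 := by
            gcongr
            exact (norm_nonneg _).trans h2
        _ = _ := by simp only [K]; ring
    calc (‖LiP (homog γ n) z‖₊ : ℝ≥0∞) = ENNReal.ofReal ‖LiP (homog γ n) z‖ := by
          rw [ofReal_norm]; rfl
      _ ≤ _ := ENNReal.ofReal_le_ofReal h4
  refine (ENNReal.tsum_le_tsum hle).trans_lt ?_
  have hs : Summable fun n => B n * K := hBs.mul_right K
  exact hs.tsum_ofReal_lt_top

lemma exists_radii {R₁ R₂ r : ℝ} (hR₁0 : 0 < R₁) (hR₂0 : 0 < R₂) (hr0 : 0 ≤ r) (hr : r < R₁ * R₂) :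
    ∃ r₁ r₂, 0 < r₁ ∧ r₁ < R₁ ∧ 0 < r₂ ∧ r₂ < R₂ ∧ r < r₁ * r₂ := by
  obtain ⟨r₁, h1, h2⟩ := exists_between ((div_lt_iff₀ hR₂0).2 hr)
  have h10 : 0 < r₁ := lt_of_le_of_lt (by positivity) h1
  have h3 : r / r₁ < R₂ := by
    rw [div_lt_iff₀ hR₂0] at h1
    rw [div_lt_iff₀ h10]; linarith
  obtain ⟨r₂, h4, h5⟩ := exists_between h3
  refine ⟨r₁, r₂, h10, h2, lt_of_le_of_lt (by positivity) h4, h5, ?_⟩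
  rw [div_lt_iff₀ h10] at h4
  linarith

lemma stuf_bound {α β : Comp → ℂ} {R₁ R₂ r₁ r₂ : ℝ} (hR₁1 : R₁ ≤ 1) (hR₂1 : R₂ ≤ 1)
    (hα : α ∈ DomR R₁) (hβ : β ∈ DomR R₂) (h10 : 0 < r₁) (h1 : r₁ < R₁) (h20 : 0 < r₂)
    (h2 : r₂ < R₂) : ∃ B : ℕ → ℝ, Summable B ∧
      ∀ n N, ‖HP (homog (stufA α β) n) N‖ ≤ B n / (r₁ * r₂) ^ N := by
  obtain ⟨A, hA0, hAs, hA⟩ := dom_bound hR₁1 hα h10 h1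
  obtain ⟨A', hA0', hAs', hA'⟩ := dom_bound hR₂1 hβ h20 h2
  refine ⟨fun n => ∑ pq ∈ Finset.HasAntidiagonal.antidiagonal n, A pq.1 * A' pq.2,
    summable_sum_mul_antidiagonal_of_summable_mul (hAs.mul_of_nonneg hAs' hA0 hA0'), ?_⟩
  intro n N
  rw [HP_stufA, Finset.sum_div]
  refine (norm_sum_le _ _).trans (Finset.sum_le_sum fun pq _ => ?_)
  rw [norm_mul, mul_pow, mul_div_mul_comm]
  have := hA0 pq.1
  gcongr
  · exact hA _ _
  · exact hA' _ _

lemma taylor_eq {α : Comp → ℂ} {R : ℝ} (hR0 : 0 < R) (hR1 : R ≤ 1)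
    (hα : α ∈ DomR R) {Hα : ℕ → ℂ}
    (hHα : ∀ z : ℂ, ‖z‖ < R →
      HasSum (fun N : ℕ => Hα N * z ^ N)
        ((∑' n : ℕ, LiP (homog α n) z) / (1 - z))) (N : ℕ) :
    Hα N = (∑' n, HP (homog α n) N) ∧ Summable fun n => ‖HP (homog α n) N‖ := by
  have hh : 0 < R / 2 := by positivity
  obtain ⟨A, hA0, hAs, hA⟩ := dom_bound hR1 hα hh (by linarith)
  constructor
  · have := coeff_unique hh (fun z hz => hHα z (by linarith))
      (fun z hz => hasSum_total hh (by linarith) hAs hA z hz)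
    exact congrFun this N
  · exact Summable.of_nonneg_of_le (fun _ => norm_nonneg _) (fun n => hA n N) (hAs.div_const _)

/-- Let `α ∈ Dom_{R₁}`, `β ∈ Dom_{R₂}` with Taylor coefficients `Hα`, `Hβ` of
`Li_α(z)/(1−z)`, `Li_β(z)/(1−z)`.  Then `α ⧛ β ∈ Dom_{R₁R₂}`, and for
`|z| < R₁R₂` one has the Hadamard-product identity
`Σ_N Hα(N)·Hβ(N)·z^N = Li_{α⧛β}(z)/(1−z)`. -/
theorem stuffle_of_domains_hadamard (R₁ R₂ : ℝ) (hR₁0 : 0 < R₁) (hR₁1 : R₁ ≤ 1)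
    (hR₂0 : 0 < R₂) (hR₂1 : R₂ ≤ 1) (α β : Comp → ℂ)
    (hα : α ∈ DomR R₁) (hβ : β ∈ DomR R₂) (Hα Hβ : ℕ → ℂ)
    (hHα : ∀ z : ℂ, ‖z‖ < R₁ →
      HasSum (fun N : ℕ => Hα N * z ^ N)
        ((∑' n : ℕ, LiP (homog α n) z) / (1 - z)))
    (hHβ : ∀ z : ℂ, ‖z‖ < R₂ →
      HasSum (fun N : ℕ => Hβ N * z ^ N)
        ((∑' n : ℕ, LiP (homog β n) z) / (1 - z))) :
    stufA α β ∈ DomR (R₁ * R₂) ∧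
    ∀ z : ℂ, ‖z‖ < R₁ * R₂ →
      HasSum (fun N : ℕ => Hα N * Hβ N * z ^ N)
        ((∑' n : ℕ, LiP (homog (stufA α β) n) z) / (1 - z)) := by
  constructor
  · intro r hr0 hr
    obtain ⟨r₁, r₂, h10, h1, h20, h2, h⟩ := exists_radii hR₁0 hR₂0 hr0.le hr
    obtain ⟨B, hBs, hB⟩ := stuf_bound hR₁1 hR₂1 hα hβ h10 h1 h20 h2
    exact mem_dom hr0 h (mul_le_one₀ (by linarith) h20.le (by linarith)) hBs hB
  · intro z hz
    obtain ⟨r₁, r₂, h10, h1, h20, h2, h⟩ := exists_radii hR₁0 hR₂0 (norm_nonneg z) hz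
    obtain ⟨B, hBs, hB⟩ := stuf_bound hR₁1 hR₂1 hα hβ h10 h1 h20 h2
    have := hasSum_total (mul_pos h10 h20) (mul_le_one₀ (by linarith) h20.le (by linarith))
      hBs hB z h
    convert this using 2 with N
    obtain ⟨e1, s1⟩ := taylor_eq hR₁0 hR₁1 hα hHα N
    obtain ⟨e2, s2⟩ := taylor_eq hR₂0 hR₂1 hβ hHβ N
    rw [e1, e2, tsum_mul_tsum_eq_tsum_sum_antidiagonal_of_summable_norm s1 s2]
    simp_rw [HP_stufA]
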